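/- Let 𝒳 and 𝒴 be compact pmm spaces with ε := dc(𝒳,𝒴). (i) For every compact pmm-subspace 𝒳' of 𝒳 there exists a compact pmm-subspace 𝒴' of 𝒴 such that dc(𝒳',𝒴') ≤ dc(𝒳,𝒴). (ii) Moreover, for any r ≥ 2ε, if in addition B̄_r(𝒳) ⪯ 𝒳' ⪯ 𝒳, then 𝒴' can be chosen so that B̄_{r−2ε}(𝒴) ⪯ 𝒴' ⪯ 𝒴. -/

import Mathlib

open MeasureTheory Topology Filter

noncomputable section

/-- Prokhorov distance between finite Borel measures on a metric space. -/
def prokhorovDist {Z : Type*} [MetricSpace Z] [MeasurableSpace Z]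
    (μ ν : Measure Z) : ℝ :=
  sInf {ε : ℝ | 0 < ε ∧ ∀ A : Set Z, IsClosed A →
    μ A ≤ ν (Metric.cthickening ε A) + ENNReal.ofReal ε ∧
    ν A ≤ μ (Metric.cthickening ε A) + ENNReal.ofReal ε}

/-- A pointed measured metric space: a metric space with a distinguished point and a Borel
measure. -/
structure PMM : Type 1 where
  carrier : Type
  metric : MetricSpace carrier
  basepoint : carrier
  meas : @Measure carrier
    (@borel carrier metric.toPseudoMetricSpace.toUniformSpace.toTopologicalSpace)

attribute [instance] PMM.metric

instance PMM.instMeasurableSpace (𝒳 : PMM) : MeasurableSpace 𝒳.carrier := borel 𝒳.carrier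

instance PMM.instBorelSpace (𝒳 : PMM) : BorelSpace 𝒳.carrier := ⟨rfl⟩

/-- A pmm space is boundedly compact if every closed ball is compact and has finite measure. -/
def PMM.BoundedlyCompact (𝒳 : PMM) : Prop :=
  (∀ (x : 𝒳.carrier) (r : ℝ), IsCompact (Metric.closedBall x r)) ∧
  (∀ (x : 𝒳.carrier) (r : ℝ), 𝒳.meas (Metric.closedBall x r) ≠ ⊤)

/-- A pmm space is compact if its carrier is compact and its measure is finite. -/
def PMM.IsCompactPMM (𝒳 : PMM) : Prop :=
  CompactSpace 𝒳.carrier ∧ 𝒳.meas Set.univ ≠ ⊤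

/-- A pair of maps of two pmm spaces into a common metric space. -/
structure GHPEmbedding (𝒳 𝒴 : PMM) : Type 1 where
  Z : Type
  mZ : MetricSpace Z
  f : 𝒳.carrier → Z
  g : 𝒴.carrier → Z

attribute [instance] GHPEmbedding.mZ

/-- Both maps of a `GHPEmbedding` are isometric embeddings. -/
def GHPEmbedding.IsIsometric {𝒳 𝒴 : PMM} (e : GHPEmbedding 𝒳 𝒴) : Prop :=
  Isometry e.f ∧ Isometry e.g

/-- The quantity `max(d(f o_X, g o_Y), dH(f(X), g(Y)), dP(f_*μ_X, g_*μ_Y))` associated to a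
pair of embeddings into a common space. -/
def GHPEmbedding.value {𝒳 𝒴 : PMM} (e : GHPEmbedding 𝒳 𝒴) : ℝ :=
  letI : MeasurableSpace e.Z := borel e.Z
  max (dist (e.f 𝒳.basepoint) (e.g 𝒴.basepoint))
    (max (Metric.hausdorffDist (Set.range e.f) (Set.range e.g))
      (prokhorovDist (𝒳.meas.map e.f) (𝒴.meas.map e.g)))

/-- The Gromov-Hausdorff-Prokhorov distance of compact pmm spaces. -/
def cGHP (𝒳 𝒴 : PMM) : ℝ :=
  sInf {x : ℝ | ∃ e : GHPEmbedding 𝒳 𝒴, e.IsIsometric ∧ x = e.value}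

/-- A pmm-subspace of a pmm space `𝒳`: a subset containing the basepoint together with a
measure `≤ 𝒳.meas` supported on the subset. -/
structure SubPMM (𝒳 : PMM) where
  set : Set 𝒳.carrier
  root_mem : 𝒳.basepoint ∈ set
  meas : Measure 𝒳.carrier
  meas_le : meas ≤ 𝒳.meas
  supported : meas setᶜ = 0

/-- The pmm space associated to a pmm-subspace. -/
def SubPMM.toPMM {𝒳 : PMM} (S : SubPMM 𝒳) : PMM where
  carrier := ↥S.set
  metric := inferInstance
  basepoint := ⟨𝒳.basepoint, S.root_mem⟩
  meas := @Measure.comap ↥S.set 𝒳.carrier (borel ↥S.set) inferInstance Subtype.val S.meas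

/-- The pmm-subspace ordering: inclusion of sets and inequality of measures. -/
instance {𝒳 : PMM} : LE (SubPMM 𝒳) :=
  ⟨fun S T => S.set ⊆ T.set ∧ S.meas ≤ T.meas⟩

/-- Compactness of a pmm-subspace. -/
def SubPMM.IsCompactSub {𝒳 : PMM} (S : SubPMM 𝒳) : Prop :=
  IsCompact S.set ∧ S.meas Set.univ ≠ ⊤

/-- The closed ball of radius `r` around the basepoint, as a pmm-subspace (for `r ≥ 0` the
underlying set is exactly the closed ball; the basepoint is inserted so that the definition
makes sense for all `r`). -/
def PMM.ballSub (𝒳 : PMM) (r : ℝ) : SubPMM 𝒳 where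
  set := insert 𝒳.basepoint (Metric.closedBall 𝒳.basepoint r)
  root_mem := Set.mem_insert _ _
  meas := 𝒳.meas.restrict (insert 𝒳.basepoint (Metric.closedBall 𝒳.basepoint r))
  meas_le := Measure.restrict_le_self
  supported := by
    rw [Measure.restrict_apply ((measurableSet_closedBall.insert 𝒳.basepoint).compl),
      Set.compl_inter_self]
    simp

/-- The quantity `a(ε, r; 𝒳, 𝒴)`. -/
def aFun (ε r : ℝ) (𝒳 𝒴 : PMM) : ℝ :=
  sInf {x : ℝ | ∃ Y' : SubPMM 𝒴, Y'.IsCompactSub ∧ 𝒴.ballSub (r - ε) ≤ Y' ∧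
    x = cGHP ((𝒳.ballSub r).toPMM) Y'.toPMM}

/-- The quantity `a_ε(𝒳, 𝒴) = a(ε, 1/ε; 𝒳, 𝒴)`. -/
def aEps (ε : ℝ) (𝒳 𝒴 : PMM) : ℝ := aFun ε (1 / ε) 𝒳 𝒴

/-- The Gromov-Hausdorff-Prokhorov distance of boundedly compact pmm spaces
(with `inf ∅ = 1`). -/
def GHP (𝒳 𝒴 : PMM) : ℝ :=
  sInf (insert 1 {ε : ℝ | ε ∈ Set.Ioc (0 : ℝ) 1 ∧ max (aEps ε 𝒳 𝒴) (aEps ε 𝒴 𝒳) < ε / 2})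

/-- Two pmm spaces are GHP-isometric if there is a root-preserving measure-preserving
surjective isometry between them. -/
def GHPIsometric (𝒳 𝒴 : PMM) : Prop :=
  ∃ ρ : 𝒳.carrier → 𝒴.carrier, Isometry ρ ∧ Function.Surjective ρ ∧
    ρ 𝒳.basepoint = 𝒴.basepoint ∧ 𝒳.meas.map ρ = 𝒴.meas

/-- `r` is a continuity radius of a pmm space. -/
def PMM.ContinuityRadius (𝒳 : PMM) (r : ℝ) : Prop :=
  0 < r ∧ Metric.closedBall 𝒳.basepoint r = closure (Metric.ball 𝒳.basepoint r) ∧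
    𝒳.meas (Metric.closedBall 𝒳.basepoint r \ Metric.ball 𝒳.basepoint r) = 0

theorem measure_le_of_forall_integral_le {X : Type*} [MetricSpace X] [MeasurableSpace X]
    [BorelSpace X] (α μ : Measure X) [IsFiniteMeasure α] [IsFiniteMeasure μ]
    (h : ∀ u : C(X, ℝ), (∀ x, 0 ≤ u x) → (∀ x, u x ≤ 1) → ∫ x, u x ∂α ≤ ∫ x, u x ∂μ) :
    α ≤ μ := by
  have hclosed : ∀ F : Set X, IsClosed F → α F ≤ μ F := by
    intro F hF
    have hpos : ∀ n : ℕ, (0 : ℝ) < 1 / ((n : ℝ) + 1) := fun n => Nat.one_div_pos_of_nat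
    have hlim : Tendsto (fun n : ℕ => 1 / ((n : ℝ) + 1)) atTop (𝓝 0) :=
      tendsto_one_div_add_atTop_nhds_zero_nat
    have h1 := tendsto_integral_thickenedIndicator_of_isClosed α hF hpos hlim
    have h2 := tendsto_integral_thickenedIndicator_of_isClosed μ hF hpos hlim
    have h3 : α.real F ≤ μ.real F := by
      refine le_of_tendsto_of_tendsto' h1 h2 (fun n => ?_)
      refine h ⟨fun x => (thickenedIndicator (hpos n) F x : ℝ), by fun_prop⟩
        (fun x => NNReal.coe_nonneg _) (fun x => ?_)
      exact_mod_cast thickenedIndicator_le_one (hpos n) F x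
    exact (ENNReal.toReal_le_toReal (measure_ne_top _ _) (measure_ne_top _ _)).1 h3
  refine Measure.le_iff.2 (fun s hs => ?_)
  rw [hs.measure_eq_iSup_isClosed_of_ne_top (measure_ne_top α s)]
  refine iSup_le fun F => iSup_le fun hF => iSup_le fun hFc => ?_
  exact (hclosed F hFc).trans (measure_mono hF)

/-- layer cake estimate -/
theorem cut_bound {X Y : Type*} [TopologicalSpace X] [TopologicalSpace Y]
    [MeasurableSpace X] [MeasurableSpace Y]
    [BorelSpace X] [BorelSpace Y] (μ : Measure X) (ν : Measure Y) 
    (K : Set (X × Y)) (ε : ENNReal)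
    (h : ∀ A : Set X, IsClosed A → μ A ≤ ν {y | ∃ x ∈ A, (x, y) ∈ K} + ε)
    (u : X → ℝ) (v : Y → ℝ) (hu : Continuous u) (hv : Continuous v) 
    (hu0 : ∀ x, 0 ≤ u x) (hv0 : ∀ y, 0 ≤ v y)
    (huv : ∀ q ∈ K, 1 ≤ u q.1 + v q.2) :
    μ Set.univ ≤ ∫⁻ x, ENNReal.ofReal (u x) ∂μ + ∫⁻ y, ENNReal.ofReal (v y) ∂ν + ε := by
  have e1 := lintegral_eq_lintegral_meas_lt μ (f := u) (ae_of_all _ hu0)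
    hu.measurable.aemeasurable
  have e2 := lintegral_eq_lintegral_meas_le ν (f := v) (ae_of_all _ hv0)
    hv.measurable.aemeasurable
  have m1 : Measurable (fun t : ℝ => μ {a | t < u a}) :=
    Antitone.measurable (fun s t hst => measure_mono (fun a (ha : t < u a) => lt_of_le_of_lt hst ha))
  have m2 : Measurable (fun t : ℝ => ν {a | t ≤ v a}) :=
    Antitone.measurable (fun s t hst => measure_mono (fun a (ha : t ≤ v a) => le_trans hst ha))
  have key : ∀ t ∈ Set.Ioo (0:ℝ) 1, μ Set.univ ≤ μ {a | t < u a} + (ν {a | 1 - t ≤ v a} + ε) := by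
    intro t ht
    have hc : IsClosed {a | u a ≤ t} := isClosed_le hu continuous_const
    have : (Set.univ : Set X) ⊆ {a | t < u a} ∪ {a | u a ≤ t} := by
      intro a _
      rcases lt_or_ge t (u a) with h | h
      · exact Or.inl h
      · exact Or.inr h
    refine (measure_mono this).trans ((measure_union_le _ _).trans ?_)
    gcongr
    refine (h _ hc).trans ?_
    refine add_le_add (measure_mono ?_) le_rfl
    rintro y ⟨x, hx, hxy⟩
    have := huv _ hxy
    simp only [Set.mem_ofPred_eq] at hx this ⊢
    linarith
  calc μ Set.univ = ∫⁻ t in Set.Ioo (0:ℝ) 1, μ Set.univ := by simp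
    _ ≤ ∫⁻ t in Set.Ioo (0:ℝ) 1, (μ {a | t < u a} + (ν {a | 1 - t ≤ v a} + ε)) := by
        refine setLIntegral_mono' measurableSet_Ioo key
    _ = (∫⁻ t in Set.Ioo (0:ℝ) 1, μ {a | t < u a}) + 
        ((∫⁻ t in Set.Ioo (0:ℝ) 1, ν {a | 1 - t ≤ v a}) + ε) := by
        rw [lintegral_add_left m1, lintegral_add_right _ measurable_const]
        simp
    _ ≤ _ := by
        rw [e1, e2, add_assoc]
        have s1 : Set.Ioo (0:ℝ) 1 ⊆ Set.Ioi 0 := fun x hx => hx.1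
        have : ∫⁻ t in Set.Ioo (0:ℝ) 1, ν {a | 1 - t ≤ v a} = 
            ∫⁻ t in Set.Ioo (0:ℝ) 1, ν {a | t ≤ v a} := by
          have hmp : MeasurePreserving (fun t : ℝ => 1 - t) volume volume :=
            Measure.measurePreserving_sub_left volume 1
          have := hmp.setLIntegral_comp_preimage (s := Set.Ioo (0:ℝ) 1) measurableSet_Ioo m2
          rw [← this]
          congr 2
          ext t; simp
        rw [this]
        gcongr

theorem integrable_of_compactSpace {Z : Type*} [TopologicalSpace Z] [CompactSpace Z]
    [MeasurableSpace Z] [OpensMeasurableSpace Z] (m : Measure Z) [IsFiniteMeasure m]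
    (u : C(Z, ℝ)) : Integrable (fun x => u x) m :=
  u.continuous.integrable_of_hasCompactSupport (HasCompactSupport.of_compactSpace _)

/-- values of the dual problem -/
def dualSet {X Y : Type*} [TopologicalSpace X] [TopologicalSpace Y] [MeasurableSpace X]
    [MeasurableSpace Y] (μ : Measure X) (ν : Measure Y) (K : Set (X × Y)) (φ : C(X × Y, ℝ)) :
    Set ℝ :=
  {t | ∃ (u : C(X, ℝ)) (v : C(Y, ℝ)), (∀ x, 0 ≤ u x) ∧ (∀ y, 0 ≤ v y) ∧
    (∀ q ∈ K, φ q ≤ u q.1 + v q.2) ∧ t = ∫ x, u x ∂μ + ∫ y, v y ∂ν}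

theorem dualSet_bdd {X Y : Type*} [TopologicalSpace X] [TopologicalSpace Y] [MeasurableSpace X]
    [MeasurableSpace Y] (μ : Measure X) (ν : Measure Y) (K : Set (X × Y)) (φ : C(X × Y, ℝ)) :
    ∀ t ∈ dualSet μ ν K φ, 0 ≤ t := by
  rintro t ⟨u, v, hu, hv, -, rfl⟩
  exact add_nonneg (integral_nonneg hu) (integral_nonneg hv)

theorem exists_positive_functional {X Y : Type*} [MetricSpace X] [MetricSpace Y]
    [CompactSpace X] [CompactSpace Y] [MeasurableSpace X] [MeasurableSpace Y]
    [BorelSpace X] [BorelSpace Y] (μ : Measure X) (ν : Measure Y) [IsFiniteMeasure μ]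
    [IsFiniteMeasure ν] (K : Set (X × Y)) (hKne : K.Nonempty) :
    ∃ Λ : C(X × Y, ℝ) →ₗ[ℝ] ℝ, (Λ 1 = sInf (dualSet μ ν K 1)) ∧
      (∀ φ, ∀ t ∈ dualSet μ ν K φ, Λ φ ≤ t) := by
  set p : C(X × Y, ℝ) → ℝ := fun φ => sInf (dualSet μ ν K φ) with hp
  have hbdd : ∀ φ, BddBelow (dualSet μ ν K φ) := fun φ => ⟨0, dualSet_bdd μ ν K φ⟩
  have hne : ∀ φ, (dualSet μ ν K φ).Nonempty := fun φ =>
    ⟨_, ContinuousMap.const X ‖φ‖, 0, fun _ => norm_nonneg φ, fun _ => le_rfl,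
      fun q _ => by simpa using (le_abs_self _).trans (φ.norm_coe_le_norm q), rfl⟩
  have hp0 : ∀ φ, 0 ≤ p φ := fun φ => Real.sInf_nonneg (dualSet_bdd μ ν K φ)
  have hsm : ∀ c : ℝ, 0 < c → ∀ φ, p (c • φ) ≤ c * p φ := by
    intro c hc φ
    have : p (c • φ) / c ≤ p φ := by
      refine le_csInf (hne φ) ?_
      rintro t ⟨u, v, hu, hv, h, rfl⟩
      rw [div_le_iff₀ hc]
      refine csInf_le (hbdd _) ⟨c • u, c • v, fun x => ?_, fun x => ?_, fun q hq => ?_, ?_⟩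
      · exact mul_nonneg hc.le (hu x)
      · exact mul_nonneg hc.le (hv x)
      · have := mul_le_mul_of_nonneg_left (h q hq) hc.le
        simpa [mul_add] using this
      · simp [integral_const_mul]; ring
    rw [div_le_iff₀ hc] at this
    linarith
  have hhom : ∀ c : ℝ, 0 < c → ∀ φ, p (c • φ) = c * p φ := by
    intro c hc φ
    refine le_antisymm (hsm c hc φ) ?_
    have := hsm c⁻¹ (inv_pos.2 hc) (c • φ)
    rw [smul_smul, inv_mul_cancel₀ hc.ne', one_smul] at this
    calc c * p φ ≤ c * (c⁻¹ * p (c • φ)) := mul_le_mul_of_nonneg_left this hc.le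
      _ = _ := by field_simp
  have hadd : ∀ φ ψ, p (φ + ψ) ≤ p φ + p ψ := by
    intro φ ψ
    refine le_of_forall_pos_le_add fun δ hδ => ?_
    obtain ⟨t, ht, htl⟩ := exists_lt_of_csInf_lt (hne φ) (show p φ < p φ + δ / 2 by linarith)
    obtain ⟨s, hs, hsl⟩ := exists_lt_of_csInf_lt (hne ψ) (show p ψ < p ψ + δ / 2 by linarith)
    have : p (φ + ψ) ≤ t + s := by
      obtain ⟨u, v, hu, hv, h, rfl⟩ := ht
      obtain ⟨u', v', hu', hv', h', rfl⟩ := hs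
      refine csInf_le (hbdd _) ⟨u + u', v + v', fun x => add_nonneg (hu x) (hu' x),
        fun x => add_nonneg (hv x) (hv' x), fun q hq => ?_, ?_⟩
      · have := h q hq
        have := h' q hq
        simp only [ContinuousMap.add_apply]
        linarith
      · simp only [ContinuousMap.add_apply]
        rw [integral_add, integral_add]
        · ring
        all_goals exact integrable_of_compactSpace _ _
    linarith
  have h1 : (1 : C(X × Y, ℝ)) ≠ 0 := by
    obtain ⟨q, -⟩ := hKne
    intro h
    have := DFunLike.congr_fun h q
    simp at this
  obtain ⟨Λ, hΛ, hΛp⟩ := exists_extension_of_le_sublinear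
    (LinearPMap.mkSpanSingleton (K := ℝ) (1 : C(X × Y, ℝ)) (p 1) h1) p hhom hadd (by
      rintro ⟨x, hx⟩
      obtain ⟨c, rfl⟩ := Submodule.mem_span_singleton.1 hx
      refine (LinearPMap.mkSpanSingleton'_apply _ _ _ c hx).le.trans ?_
      simp only [smul_eq_mul]
      rcases lt_or_ge 0 c with hc | hc
      · exact (hhom c hc 1).ge
      · exact (mul_nonpos_of_nonpos_of_nonneg hc (hp0 1)).trans (hp0 _))
  refine ⟨Λ, ?_, fun φ t ht => (hΛp φ).trans (csInf_le (hbdd φ) ht)⟩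
  have := hΛ ⟨(1 : ℝ) • 1, Submodule.mem_span_singleton.2 ⟨1, rfl⟩⟩
  have := this.trans (LinearPMap.mkSpanSingleton'_apply _ _ _ _ _)
  simpa using this

theorem finite_strassen {X Y : Type*} [MetricSpace X] [MetricSpace Y]
    [CompactSpace X] [CompactSpace Y] [MeasurableSpace X] [MeasurableSpace Y]
    [BorelSpace X] [BorelSpace Y] (μ : Measure X) (ν : Measure Y) [IsFiniteMeasure μ]
    [IsFiniteMeasure ν] (K : Set (X × Y)) (hK : IsClosed K) (hKne : K.Nonempty) (ε : ENNReal)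
    (h1 : ∀ A : Set X, IsClosed A → μ A ≤ ν {y | ∃ x ∈ A, (x, y) ∈ K} + ε)
    (h2 : ∀ B : Set Y, IsClosed B → ν B ≤ μ {x | ∃ y ∈ B, (x, y) ∈ K} + ε) :
    ∃ α : Measure (X × Y), IsFiniteMeasure α ∧ α Kᶜ = 0 ∧ α.map Prod.fst ≤ μ ∧
      α.map Prod.snd ≤ ν ∧ μ Set.univ ≤ α Set.univ + ε ∧ ν Set.univ ≤ α Set.univ + ε := by
  obtain ⟨Λ, hΛ1, hΛ⟩ := exists_positive_functional μ ν K hKne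
  have hneg : ∀ φ : C(X × Y, ℝ), (∀ q ∈ K, φ q ≤ 0) → Λ φ ≤ 0 := fun φ h =>
    hΛ φ 0 ⟨0, 0, fun _ => le_rfl, fun _ => le_rfl, fun q hq => by simpa using h q hq, by simp⟩
  let Λ' : CompactlySupportedContinuousMap (X × Y) ℝ →ₚ[ℝ] ℝ := PositiveLinearMap.mk₀
    { toFun := fun f => Λ f.toContinuousMap
      map_add' := fun f g => by rw [← map_add]; rfl
      map_smul' := fun c f => by rw [RingHom.id_apply, ← map_smul]; rfl }
    (fun f hf => by
      have := hneg (-f.toContinuousMap) (fun q _ => by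
        have := hf q
        simpa using this)
      rw [map_neg] at this
      simpa using this)
  set α := RealRMK.rieszMeasure Λ' with hα
  have hIntΛ : ∀ φ : C(X × Y, ℝ), ∫ q, φ q ∂α = Λ φ := fun φ =>
    RealRMK.integral_rieszMeasure Λ' (CompactlySupportedContinuousMap.continuousMapEquiv φ)
  have hmass : ENNReal.ofReal (sInf (dualSet μ ν K 1)) = α Set.univ := by
    have := hIntΛ 1
    rw [hΛ1] at this
    rw [← this]
    simp
  have hlim : ∀ m : ENNReal, (∀ t ∈ dualSet μ ν K 1, m ≤ ENNReal.ofReal t + ε) →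
      m ≤ α Set.univ + ε := by
    intro m hm
    rw [← hmass]
    have hne : (dualSet μ ν K 1).Nonempty :=
      ⟨_, 1, 0, fun _ => zero_le_one, fun _ => le_rfl, fun q _ => by simp, rfl⟩
    obtain ⟨s, -, hs, hs'⟩ := exists_seq_tendsto_sInf hne ⟨0, dualSet_bdd μ ν K 1⟩
    refine ge_of_tendsto' (x := atTop) (f := fun n => ENNReal.ofReal (s n) + ε) ?_
      (fun n => hm _ (hs' n))
    exact ((ENNReal.continuous_ofReal.tendsto _).comp hs).add tendsto_const_nhds
  refine ⟨α, inferInstance, ?_, ?_, ?_, hlim _ ?_, hlim _ ?_⟩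
  · let φ : C(X × Y, ℝ) := ⟨fun q => Metric.infDist q K, Metric.continuous_infDist_pt K⟩
    have hle : ∫ q, φ q ∂α ≤ 0 := by
      rw [hIntΛ]
      exact hneg φ (fun q hq => (Metric.infDist_zero_of_mem hq).le)
    have hz : ∫ q, φ q ∂α = 0 := le_antisymm hle (integral_nonneg fun q => Metric.infDist_nonneg)
    rw [integral_eq_zero_iff_of_nonneg (f := fun q => φ q) (fun q => Metric.infDist_nonneg) (integrable_of_compactSpace α φ)] at hz
    refine measure_mono_null ?_ hz
    intro q hq hq'
    exact hq ((hK.mem_iff_infDist_zero hKne).2 hq')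
  · refine measure_le_of_forall_integral_le _ _ fun u hu _ => ?_
    rw [integral_map measurable_fst.aemeasurable u.continuous.aestronglyMeasurable]
    refine (hIntΛ (u.comp ⟨Prod.fst, continuous_fst⟩)).le.trans (hΛ _ _ ⟨u, 0, hu, fun _ => le_rfl,
      fun q _ => by simp, by simp⟩)
  · refine measure_le_of_forall_integral_le _ _ fun v hv _ => ?_
    rw [integral_map measurable_snd.aemeasurable v.continuous.aestronglyMeasurable]
    refine (hIntΛ (v.comp ⟨Prod.snd, continuous_snd⟩)).le.trans (hΛ _ _ ⟨0, v, fun _ => le_rfl, hv,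
      fun q _ => by simp, by simp⟩)
  · rintro t ⟨u, v, hu, hv, huv, rfl⟩
    refine (cut_bound μ ν K ε h1 u v u.continuous v.continuous hu hv huv).trans_eq ?_
    rw [ENNReal.ofReal_add (integral_nonneg hu) (integral_nonneg hv),
      ofReal_integral_eq_lintegral_ofReal (integrable_of_compactSpace μ u) (ae_of_all _ hu),
      ofReal_integral_eq_lintegral_ofReal (integrable_of_compactSpace ν v) (ae_of_all _ hv)]
  · rintro t ⟨u, v, hu, hv, huv, rfl⟩
    refine (cut_bound ν μ (Prod.swap ⁻¹' K) ε h2 v u v.continuous u.continuous hv hu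
      (fun q hq => by have := huv _ hq; simpa [add_comm] using this)).trans_eq ?_
    rw [ENNReal.ofReal_add (integral_nonneg hu) (integral_nonneg hv),
      ofReal_integral_eq_lintegral_ofReal (integrable_of_compactSpace μ u) (ae_of_all _ hu),
      ofReal_integral_eq_lintegral_ofReal (integrable_of_compactSpace ν v) (ae_of_all _ hv)]
    rw [add_comm (∫⁻ y, ENNReal.ofReal (v y) ∂ν)]

theorem sub_coupling {X Y : Type*} [MeasurableSpace X] [MeasurableSpace Y]
    (μ : Measure X) (ν : Measure Y) [IsFiniteMeasure μ] [IsFiniteMeasure ν]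
    (K : Set (X × Y)) (ε : ENNReal)
    (α : Measure (X × Y)) [IsFiniteMeasure α] (hαK : α Kᶜ = 0) (hα1 : α.map Prod.fst ≤ μ)
    (hα2 : α.map Prod.snd ≤ ν) (hm1 : μ Set.univ ≤ α Set.univ + ε)
    (hm2 : ν Set.univ ≤ α Set.univ + ε)
    (μ' : Measure X) (hμ' : μ' ≤ μ) (X' : Set X) (hX'm : MeasurableSet X') (hX' : μ' X'ᶜ = 0)
    (Y' : Set Y) (hY'm : MeasurableSet Y') (hY' : ∀ q ∈ K, q.1 ∈ X' → q.2 ∈ Y') :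
    ∃ (ν' : Measure Y) (α' : Measure (X × Y)), ν' ≤ ν ∧ ν' Y'ᶜ = 0 ∧ α' Kᶜ = 0 ∧
      α'.map Prod.fst ≤ μ' ∧ α'.map Prod.snd ≤ ν' ∧ μ' Set.univ ≤ α' Set.univ + ε ∧
      ν' Set.univ ≤ α' Set.univ + ε ∧
      ∀ (R : Set X) (B : Set Y), MeasurableSet R → MeasurableSet B → μ.restrict R ≤ μ' →
        B ⊆ Y' → (∀ q ∈ K, q.2 ∈ B → q.1 ∈ R) → ν.restrict B ≤ ν' := by
  have : IsFiniteMeasure μ' := isFiniteMeasure_of_le μ hμ'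
  have hac : μ' ≪ μ := Measure.absolutelyContinuous_of_le hμ'
  set h := μ'.rnDeriv μ with hh
  have hhm : Measurable h := Measure.measurable_rnDeriv _ _
  have hμ'h : μ.withDensity h = μ' := Measure.withDensity_rnDeriv_eq _ _ hac
  have hh1 : h ≤ᵐ[μ] 1 := Measure.rnDeriv_le_one_of_le hμ'
  set ρ := μ - α.map Prod.fst with hρ
  set σ := ν - α.map Prod.snd with hσ
  have eρ : ρ + α.map Prod.fst = μ := Measure.sub_add_cancel_of_le hα1
  have eσ : σ + α.map Prod.snd = ν := Measure.sub_add_cancel_of_le hα2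
  have u1 : (α.map Prod.fst) Set.univ = α Set.univ := by
    rw [Measure.map_apply measurable_fst MeasurableSet.univ]; rfl
  have u2 : (α.map Prod.snd) Set.univ = α Set.univ := by
    rw [Measure.map_apply measurable_snd MeasurableSet.univ]; rfl
  have hρε : ρ Set.univ ≤ ε := by
    rw [← eρ, Measure.add_apply, u1, add_comm] at hm1
    exact (ENNReal.add_le_add_iff_left (measure_ne_top α _)).1 hm1
  have hσε : σ Set.univ ≤ ε := by
    rw [← eσ, Measure.add_apply, u2, add_comm] at hm2
    exact (ENNReal.add_le_add_iff_left (measure_ne_top α _)).1 hm2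
  -- transfer of a.e. statements
  have hae : ∀ P : X → Prop, (∀ᵐ x ∂μ, P x) → ∀ᵐ q ∂α, P q.1 := fun P hP =>
    ae_of_ae_map measurable_fst.aemeasurable
      ((Measure.absolutelyContinuous_of_le hα1).ae_le hP)
  set α' := α.withDensity (fun q => h q.1) with hα'
  have hhm' : Measurable (fun q : X × Y => h q.1) := hhm.comp measurable_fst
  have hα'le : α' ≤ α := by
    refine Measure.le_iff.2 fun s hs => ?_
    rw [hα', withDensity_apply _ hs, ← setLIntegral_one]
    exact lintegral_mono_ae (ae_restrict_of_ae (hae _ hh1))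
  have hα'1 : α'.map Prod.fst = (α.map Prod.fst).withDensity h := by
    ext s hs
    rw [Measure.map_apply measurable_fst hs, hα', withDensity_apply _ (measurable_fst hs),
      withDensity_apply _ hs, setLIntegral_map hs hhm measurable_fst]
  have hα'fst : α'.map Prod.fst ≤ μ' := by
    rw [hα'1, ← hμ'h]
    refine Measure.le_iff.2 fun s hs => ?_
    rw [withDensity_apply _ hs, withDensity_apply _ hs]
    exact lintegral_mono' (Measure.restrict_mono le_rfl hα1) le_rfl
  have hα'K : α' Kᶜ = 0 := le_antisymm ((hα'le _).trans hαK.le) bot_le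
  have u1' : (α'.map Prod.fst) Set.univ = α' Set.univ := by
    rw [Measure.map_apply measurable_fst MeasurableSet.univ]; rfl
  have u2' : (α'.map Prod.snd) Set.univ = α' Set.univ := by
    rw [Measure.map_apply measurable_snd MeasurableSet.univ]; rfl
  refine ⟨α'.map Prod.snd + σ.restrict Y', α', ?_, ?_, hα'K, hα'fst, ?_, ?_, ?_, ?_⟩
  · rw [← eσ, add_comm]
    exact add_le_add Measure.restrict_le_self (Measure.map_mono hα'le measurable_snd)
  · rw [Measure.add_apply, Measure.restrict_apply hY'm.compl, Set.compl_inter_self, measure_empty,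
      add_zero, Measure.map_apply measurable_snd hY'm.compl]
    have hz : α' (Prod.fst ⁻¹' X'ᶜ) = 0 := by
      rw [← Measure.map_apply measurable_fst hX'm.compl]
      exact le_antisymm ((hα'fst _).trans hX'.le) bot_le
    refine measure_mono_null ?_ (measure_union_null hα'K hz)
    intro q hq
    by_cases hqK : q ∈ K
    · exact Or.inr fun hx => hq (hY' q hqK hx)
    · exact Or.inl hqK
  · exact Measure.le_add_right le_rfl
  · have e : μ' = ρ.withDensity h + α'.map Prod.fst := by
      rw [hα'1, ← withDensity_add_measure, eρ, hμ'h]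
    rw [e, Measure.add_apply, u1', add_comm]
    refine add_le_add le_rfl (le_trans ?_ hρε)
    rw [withDensity_apply _ MeasurableSet.univ, ← setLIntegral_one]
    refine lintegral_mono_ae (ae_restrict_of_ae ?_)
    exact (Measure.absolutelyContinuous_of_le Measure.sub_le).ae_le hh1
  · rw [Measure.add_apply, u2']
    exact add_le_add le_rfl ((Measure.restrict_le_self _).trans hσε)
  · intro R B hR hB hRμ hBY hK
    have hh2 : R.indicator 1 ≤ᵐ[μ] h := by
      refine ae_le_of_forall_setLIntegral_le_of_sigmaFinite (measurable_one.indicator hR) ?_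
      intro s hs _
      rw [← withDensity_apply h hs, hμ'h, setLIntegral_indicator hR]
      simp only [Pi.one_apply, setLIntegral_one]
      rw [Set.inter_comm, ← Measure.restrict_apply' hR]
      exact hRμ s
    rw [← eσ, Measure.restrict_add, add_comm]
    refine add_le_add ?_ (Measure.restrict_mono hBY le_rfl)
    refine Measure.le_iff.2 fun s hs => ?_
    rw [Measure.restrict_apply hs, Measure.map_apply measurable_snd (hs.inter hB),
      Measure.map_apply measurable_snd hs, hα', withDensity_apply _ (measurable_snd hs)]
    have hαK' : ∀ᵐ q ∂α, q ∈ K := hαK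
    calc α (Prod.snd ⁻¹' (s ∩ B)) ≤ α ((Prod.fst ⁻¹' R) ∩ (Prod.snd ⁻¹' s)) := by
          refine measure_mono_ae ?_
          filter_upwards [hαK'] with q hq hqs
          exact ⟨hK q hq hqs.2, hqs.1⟩
      _ = ∫⁻ q in Prod.snd ⁻¹' s, (Prod.fst ⁻¹' R).indicator 1 q ∂α := by
          rw [setLIntegral_indicator (measurable_fst hR)]
          simp
      _ ≤ _ := lintegral_mono_ae (ae_restrict_of_ae (hae _ hh2))

theorem coupling_side {Ω X Y : Type*} [MeasurableSpace Ω] [MeasurableSpace X] [MeasurableSpace Y]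
    (α : Measure Ω) (p : Ω → X) (q : Ω → Y) (hp : Measurable p) (hq : Measurable q)
    (μ : Measure X) [IsFiniteMeasure μ] (ν : Measure Y) (ε : ENNReal)
    (h1 : α.map p ≤ μ) (h2 : α.map q ≤ ν) (hm : μ Set.univ ≤ α Set.univ + ε)
    (A : Set X) (B : Set Y) (hA : MeasurableSet A) (hB : MeasurableSet B)
    (hAB : ∀ᵐ ω ∂α, p ω ∈ A → q ω ∈ B) : μ A ≤ ν B + ε := by
  have e1 : α Set.univ = α.map p A + α.map p Aᶜ := by
    rw [measure_add_measure_compl hA, Measure.map_apply hp MeasurableSet.univ]; rfl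
  have e2 : α.map p A ≤ ν B := by
    refine le_trans ?_ (h2 B)
    rw [Measure.map_apply hp hA, Measure.map_apply hq hB]
    exact measure_mono_ae hAB
  have : μ A + μ Aᶜ ≤ ν B + ε + μ Aᶜ := by
    rw [measure_add_measure_compl hA]
    refine hm.trans ?_
    rw [e1]
    calc α.map p A + α.map p Aᶜ + ε ≤ ν B + μ Aᶜ + ε := by gcongr
      _ = _ := by ring
  exact (ENNReal.add_le_add_iff_right (measure_ne_top μ _)).1 this

theorem prok_side {X Y Z : Type*} [MetricSpace X] [MetricSpace Y] [MetricSpace Z]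
    [CompactSpace X] [MeasurableSpace X] [MeasurableSpace Y] [MeasurableSpace Z]
    [BorelSpace X] [BorelSpace Y] [BorelSpace Z] (μ : Measure X) (ν : Measure Y)
    (f : X → Z) (g : Y → Z) (hf : Isometry f) (hg : Isometry g) (t η : ℝ) (ht : 0 ≤ t)
    (htη : t ≤ η)
    (h : ∀ C : Set Z, IsClosed C →
      μ.map f C ≤ ν.map g (Metric.cthickening t C) + ENNReal.ofReal t)
    (A : Set X) (hA : IsClosed A) :
    μ A ≤ ν {y | ∃ x ∈ A, dist (f x) (g y) ≤ η} + ENNReal.ofReal η := by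
  have hc : IsCompact (f '' A) := hA.isCompact.image hf.continuous
  have := h _ hc.isClosed
  rw [Measure.map_apply hf.continuous.measurable hc.isClosed.measurableSet,
    Measure.map_apply hg.continuous.measurable Metric.isClosed_cthickening.measurableSet,
    Set.preimage_image_eq _ hf.injective] at this
  refine this.trans (add_le_add (measure_mono ?_) (ENNReal.ofReal_le_ofReal htη))
  intro y hy
  rw [hc.cthickening_eq_biUnion_closedBall ht] at hy
  simp only [Set.mem_preimage, Set.mem_iUnion, Metric.mem_closedBall] at hy
  obtain ⟨z, ⟨x, hx, rfl⟩, hz⟩ := hy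
  exact ⟨x, hx, by rw [dist_comm]; exact hz.trans htη⟩

theorem limit_side {X Y : Type*} [MetricSpace X] [MetricSpace Y]
    [CompactSpace X] [CompactSpace Y] [MeasurableSpace X] [MeasurableSpace Y]
    [BorelSpace X] [BorelSpace Y] (μ : Measure X) (ν : Measure Y) [IsFiniteMeasure ν]
    (D : X × Y → ℝ) (hD : Continuous D) (ε : ℝ) (A : Set X) (hA : IsClosed A)
    (h : ∀ δ > 0, μ A ≤ ν {y | ∃ x ∈ A, D (x, y) ≤ ε + δ} + ENNReal.ofReal (ε + δ)) :
    μ A ≤ ν {y | ∃ x ∈ A, D (x, y) ≤ ε} + ENNReal.ofReal ε := by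
  have hpos : ∀ n : ℕ, (0 : ℝ) < 1 / ((n : ℝ) + 1) := fun n => Nat.one_div_pos_of_nat
  have hlim : Tendsto (fun n : ℕ => 1 / ((n : ℝ) + 1)) atTop (𝓝 0) :=
    tendsto_one_div_add_atTop_nhds_zero_nat
  let S : ℕ → Set Y := fun n => {y | ∃ x ∈ A, D (x, y) ≤ ε + 1 / ((n : ℝ) + 1)}
  have hSc : ∀ n, IsClosed (S n) := by
    intro n
    have : S n = Prod.snd '' ((A ×ˢ Set.univ) ∩ {q | D q ≤ ε + 1 / ((n : ℝ) + 1)}) := by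
      ext y
      constructor
      · rintro ⟨x, hx, hxy⟩
        exact ⟨(x, y), ⟨⟨hx, trivial⟩, hxy⟩, rfl⟩
      · rintro ⟨⟨x, y⟩, ⟨⟨hx, -⟩, hxy⟩, rfl⟩
        exact ⟨x, hx, hxy⟩
    rw [this]
    exact ((((hA.prod isClosed_univ).inter
      (isClosed_le hD continuous_const)).isCompact).image continuous_snd).isClosed
  have hanti : Antitone S := by
    rintro m n hmn y ⟨x, hx, hxy⟩
    refine ⟨x, hx, hxy.trans ?_⟩
    gcongr
  have hI : ⋂ n, S n = {y | ∃ x ∈ A, D (x, y) ≤ ε} := by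
    ext y
    simp only [Set.mem_iInter]
    constructor
    · intro hy
      obtain ⟨x0, hx0, -⟩ := hy 0
      obtain ⟨x, hx, hmin⟩ := hA.isCompact.exists_isMinOn ⟨x0, hx0⟩
        (f := fun x => D (x, y)) (by fun_prop)
      refine ⟨x, hx, ?_⟩
      have hl : Tendsto (fun n : ℕ => ε + 1 / ((n : ℝ) + 1)) atTop (𝓝 (ε + 0)) :=
        tendsto_const_nhds.add hlim
      rw [add_zero] at hl
      refine ge_of_tendsto' hl fun n => ?_
      obtain ⟨x', hx', hxy'⟩ := hy n
      exact (hmin hx').trans hxy'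
    · rintro ⟨x, hx, hxy⟩ n
      exact ⟨x, hx, by have := hpos n; linarith⟩
  have t1 : Tendsto (fun n => ν (S n)) atTop (𝓝 (ν (⋂ n, S n))) :=
    tendsto_measure_iInter_atTop (fun n => (hSc n).measurableSet.nullMeasurableSet) hanti
      ⟨0, measure_ne_top _ _⟩
  have t2 : Tendsto (fun n : ℕ => ENNReal.ofReal (ε + 1 / ((n : ℝ) + 1))) atTop
      (𝓝 (ENNReal.ofReal (ε + 0))) :=
    (ENNReal.continuous_ofReal.tendsto _).comp (tendsto_const_nhds.add hlim)
  rw [hI] at t1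
  rw [add_zero] at t2
  exact ge_of_tendsto' (t1.add t2) fun n => h _ (hpos n)

theorem prokhorov_cond {Z : Type*} [MetricSpace Z] [MeasurableSpace Z]
    (μ ν : Measure Z) [IsFiniteMeasure μ] [IsFiniteMeasure ν] (η : ℝ)
    (h : prokhorovDist μ ν < η) : ∃ t : ℝ, 0 < t ∧ t ≤ η ∧ ∀ A : Set Z, IsClosed A →
    μ A ≤ ν (Metric.cthickening t A) + ENNReal.ofReal t ∧
    ν A ≤ μ (Metric.cthickening t A) + ENNReal.ofReal t := by
  obtain ⟨t, ⟨ht, hA⟩, hlt⟩ := exists_lt_of_csInf_lt (by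
    refine ⟨(μ Set.univ).toReal + (ν Set.univ).toReal + 1, by positivity, fun A _ => ⟨?_, ?_⟩⟩
    · refine le_add_left ((measure_mono (Set.subset_univ A)).trans ?_)
      rw [← ENNReal.ofReal_toReal (measure_ne_top μ Set.univ)]
      refine ENNReal.ofReal_le_ofReal ?_
      simp only [ENNReal.toReal_ofReal ENNReal.toReal_nonneg]
      have := @ENNReal.toReal_nonneg (ν Set.univ)
      linarith
    · refine le_add_left ((measure_mono (Set.subset_univ A)).trans ?_)
      rw [← ENNReal.ofReal_toReal (measure_ne_top ν Set.univ)]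
      refine ENNReal.ofReal_le_ofReal ?_
      simp only [ENNReal.toReal_ofReal ENNReal.toReal_nonneg]
      have := @ENNReal.toReal_nonneg (μ Set.univ)
      linarith) h
  exact ⟨t, ht, hlt.le, hA⟩

theorem value_cond {𝒳 𝒴 : PMM} (h𝒳 : 𝒳.IsCompactPMM) (h𝒴 : 𝒴.IsCompactPMM)
    (e : GHPEmbedding 𝒳 𝒴) (he : e.IsIsometric) (η : ℝ) (h : e.value < η) :
    dist (e.f 𝒳.basepoint) (e.g 𝒴.basepoint) ≤ η ∧
    (∀ x, ∃ y, dist (e.f x) (e.g y) ≤ η) ∧ (∀ y, ∃ x, dist (e.f x) (e.g y) ≤ η) ∧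
    (∀ A : Set 𝒳.carrier, IsClosed A →
      𝒳.meas A ≤ 𝒴.meas {y | ∃ x ∈ A, dist (e.f x) (e.g y) ≤ η} + ENNReal.ofReal η) ∧
    (∀ B : Set 𝒴.carrier, IsClosed B →
      𝒴.meas B ≤ 𝒳.meas {x | ∃ y ∈ B, dist (e.f x) (e.g y) ≤ η} + ENNReal.ofReal η) := by
  let : MeasurableSpace e.Z := borel e.Z
  have : BorelSpace e.Z := ⟨rfl⟩
  have : CompactSpace 𝒳.carrier := h𝒳.1
  have : CompactSpace 𝒴.carrier := h𝒴.1
  have : IsFiniteMeasure 𝒳.meas := ⟨h𝒳.2.lt_top⟩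
  have : IsFiniteMeasure 𝒴.meas := ⟨h𝒴.2.lt_top⟩
  have hv : e.value = max (dist (e.f 𝒳.basepoint) (e.g 𝒴.basepoint))
    (max (Metric.hausdorffDist (Set.range e.f) (Set.range e.g))
      (prokhorovDist (𝒳.meas.map e.f) (𝒴.meas.map e.g))) := rfl
  rw [hv, max_lt_iff, max_lt_iff] at h
  obtain ⟨h1, h2, h3⟩ := h
  obtain ⟨t, ht0, htη, ht⟩ := prokhorov_cond _ _ η h3
  have hfin : Metric.hausdorffEDist (Set.range e.f) (Set.range e.g) ≠ ⊤ :=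
    Metric.hausdorffEDist_ne_top_of_nonempty_of_bounded ⟨_, 𝒳.basepoint, rfl⟩
      ⟨_, 𝒴.basepoint, rfl⟩ (isCompact_range he.1.continuous).isBounded
      (isCompact_range he.2.continuous).isBounded
  refine ⟨h1.le, fun x => ?_, fun y => ?_, ?_, ?_⟩
  · obtain ⟨_, ⟨y, rfl⟩, hy⟩ := Metric.exists_dist_lt_of_hausdorffDist_lt (Set.mem_range_self x) h2 hfin
    exact ⟨y, hy.le⟩
  · obtain ⟨_, ⟨x, rfl⟩, hx⟩ := Metric.exists_dist_lt_of_hausdorffDist_lt' (Set.mem_range_self y) h2 hfin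
    exact ⟨x, hx.le⟩
  · exact prok_side _ _ e.f e.g he.1 he.2 t η ht0.le htη (fun C hC => (ht C hC).1)
  · have := prok_side _ _ e.g e.f he.2 he.1 t η ht0.le htη (fun C hC => (ht C hC).2)
    simpa only [dist_comm] using this

theorem value_nonneg {𝒳 𝒴 : PMM} (e : GHPEmbedding 𝒳 𝒴) : 0 ≤ e.value :=
  le_max_of_le_left dist_nonneg

theorem cGHP_nonneg (𝒳 𝒴 : PMM) : 0 ≤ cGHP 𝒳 𝒴 :=
  Real.sInf_nonneg (by rintro _ ⟨e, -, rfl⟩; exact value_nonneg e)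

theorem exists_embedding_lt (𝒳 𝒴 : PMM) (δ : ℝ) (hδ : 0 < δ) :
    ∃ e : GHPEmbedding 𝒳 𝒴, e.IsIsometric ∧ e.value < cGHP 𝒳 𝒴 + δ := by
  obtain ⟨_, ⟨e, he, rfl⟩, h⟩ := exists_lt_of_csInf_lt
    (s := {x : ℝ | ∃ e : GHPEmbedding 𝒳 𝒴, e.IsIsometric ∧ x = e.value}) (by
      refine ⟨_, ⟨𝒳.carrier × 𝒴.carrier, inferInstance, fun x => (x, 𝒴.basepoint),
        fun y => (𝒳.basepoint, y)⟩, ⟨?_, ?_⟩, rfl⟩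
      · exact Isometry.of_dist_eq fun x y => by simp [Prod.dist_eq]
      · exact Isometry.of_dist_eq fun x y => by simp [Prod.dist_eq])
    (show cGHP 𝒳 𝒴 < cGHP 𝒳 𝒴 + δ by linarith)
  exact ⟨e, he, h⟩

theorem exists_limit (𝒳 𝒴 : PMM) (h𝒳 : 𝒳.IsCompactPMM) (h𝒴 : 𝒴.IsCompactPMM) :
    ∃ D : 𝒳.carrier × 𝒴.carrier → ℝ, Continuous D ∧ ∀ δ > 0, ∃ e : GHPEmbedding 𝒳 𝒴,
      e.IsIsometric ∧ e.value < cGHP 𝒳 𝒴 + δ ∧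
      ∀ q, |dist (e.f q.1) (e.g q.2) - D q| ≤ δ := by
  have : CompactSpace 𝒳.carrier := h𝒳.1
  have : CompactSpace 𝒴.carrier := h𝒴.1
  have hpos : ∀ n : ℕ, (0 : ℝ) < 1 / ((n : ℝ) + 1) := fun n => Nat.one_div_pos_of_nat
  have hlim : Tendsto (fun n : ℕ => 1 / ((n : ℝ) + 1)) atTop (𝓝 0) :=
    tendsto_one_div_add_atTop_nhds_zero_nat
  choose e he hev using fun n : ℕ => exists_embedding_lt 𝒳 𝒴 _ (hpos n)
  let F : ℕ → BoundedContinuousFunction (𝒳.carrier × 𝒴.carrier) ℝ := fun n =>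
    BoundedContinuousFunction.mkOfCompact
      ⟨fun q => dist ((e n).f q.1) ((e n).g q.2),
        ((he n).1.continuous.comp continuous_fst).dist ((he n).2.continuous.comp continuous_snd)⟩
  have hF : ∀ n q, F n q = dist ((e n).f q.1) ((e n).g q.2) := fun n q => rfl
  set C : ℝ := Metric.diam (Set.univ : Set 𝒳.carrier) + (cGHP 𝒳 𝒴 + 1) +
    Metric.diam (Set.univ : Set 𝒴.carrier) with hC
  have hcomp : IsCompact (closure (Set.range F)) := by
    refine BoundedContinuousFunction.arzela_ascoli (Set.Icc 0 C) isCompact_Icc _ ?_ ?_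
    · rintro _ q ⟨n, rfl⟩
      rw [hF]
      refine ⟨dist_nonneg, ?_⟩
      have a1 := dist_triangle4 ((e n).f q.1) ((e n).f 𝒳.basepoint) ((e n).g 𝒴.basepoint)
        ((e n).g q.2)
      rw [(he n).1.dist_eq, (he n).2.dist_eq] at a1
      have a2 : dist q.1 𝒳.basepoint ≤ Metric.diam (Set.univ : Set 𝒳.carrier) :=
        Metric.dist_le_diam_of_mem isCompact_univ.isBounded trivial trivial
      have a3 : dist 𝒴.basepoint q.2 ≤ Metric.diam (Set.univ : Set 𝒴.carrier) :=
        Metric.dist_le_diam_of_mem isCompact_univ.isBounded trivial trivial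
      have a4 : dist ((e n).f 𝒳.basepoint) ((e n).g 𝒴.basepoint) ≤ (e n).value := le_max_left _ _
      have a5 := hev n
      have a6 : 1 / ((n : ℝ) + 1) ≤ 1 := by
        rw [div_le_one (by positivity)]
        have : (0 : ℝ) ≤ n := n.cast_nonneg
        linarith
      linarith
    · refine Metric.equicontinuous_of_continuity_modulus (fun t => 2 * t) ?_ _ ?_
      · have : Tendsto (fun t : ℝ => 2 * t) (𝓝 0) (𝓝 (2 * 0)) := tendsto_id.const_mul 2
        simpa using this
      · rintro p q ⟨_, n, rfl⟩
        change dist (F n p) (F n q) ≤ _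
        rw [hF, hF]
        refine (dist_dist_dist_le _ _ _ _).trans ?_
        rw [(he n).1.dist_eq, (he n).2.dist_eq, Prod.dist_eq]
        have := le_max_left (dist p.1 q.1) (dist p.2 q.2)
        have := le_max_right (dist p.1 q.1) (dist p.2 q.2)
        linarith
  obtain ⟨D, -, k, hk, hD⟩ := hcomp.tendsto_subseq (fun n => subset_closure ⟨n, rfl⟩)
  refine ⟨D, D.continuous, fun δ hδ => ?_⟩
  have ev1 := (Metric.tendsto_nhds.1 hD) δ hδ
  have ev2 : ∀ᶠ n in atTop, 1 / ((k n : ℝ) + 1) < δ :=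
    (hlim.comp hk.tendsto_atTop).eventually (gt_mem_nhds hδ)
  obtain ⟨n, h1, h2⟩ := (ev1.and ev2).exists
  refine ⟨e (k n), he _, (hev (k n)).trans (by linarith), fun q => ?_⟩
  have := (BoundedContinuousFunction.dist_coe_le_dist q).trans h1.le
  exact this

theorem map_toPMM_apply {𝒳 : PMM} (S : SubPMM 𝒳) (hS : MeasurableSet S.set) {Z : Type*}
    [MetricSpace Z] [MeasurableSpace Z] [BorelSpace Z] (f : 𝒳.carrier → Z) (hf : Continuous f)
    (C : Set Z) (hC : MeasurableSet C) :
    (S.toPMM.meas.map (fun x : S.toPMM.carrier => f (Subtype.val (p := (· ∈ S.set)) x))) C = S.meas (f ⁻¹' C) := by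
  have hb : borel ↥S.set = Subtype.instMeasurableSpace := BorelSpace.measurable_eq.symm
  have h0 : S.toPMM.meas = @Measure.comap ↥S.set 𝒳.carrier (borel ↥S.set) inferInstance
    Subtype.val S.meas := rfl
  have hm : @Measurable ↥S.set Z (borel ↥S.set) inferInstance (fun x => f x.1) := by
    rw [hb]
    exact hf.measurable.comp measurable_subtype_coe
  have hm' : Measurable (fun x : S.toPMM.carrier => f (Subtype.val (p := (· ∈ S.set)) x)) := hm
  rw [Measure.map_apply hm' hC, h0]
  have h3 : ∀ m : MeasurableSpace ↥S.set, m = Subtype.instMeasurableSpace →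
      ∀ t : Set ↥S.set, @Measure.comap ↥S.set 𝒳.carrier m inferInstance Subtype.val S.meas t =
        S.meas (Subtype.val '' t) := by
    rintro _ rfl t
    exact (MeasurableEmbedding.subtype_coe hS).comap_apply _ _
  refine (h3 _ hb ((fun x : S.set => f x.1) ⁻¹' C)).trans ?_
  have : (Subtype.val '' ((fun x : S.set => f x.1) ⁻¹' C)) = f ⁻¹' C ∩ S.set := by
    ext x
    simp [and_comm]
  rw [this]
  refine le_antisymm (measure_mono Set.inter_subset_left) ?_
  refine (measure_mono (t := (f ⁻¹' C ∩ S.set) ∪ S.setᶜ) ?_).trans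
    ((measure_union_le _ _).trans (by rw [S.supported, add_zero]))
  intro x hx
  by_cases h : x ∈ S.set
  · exact Or.inl ⟨hx, h⟩
  · exact Or.inr h

theorem cGHP_core (𝒳 𝒴 : PMM) (h𝒳 : 𝒳.IsCompactPMM) (h𝒴 : 𝒴.IsCompactPMM)
    (X' : SubPMM 𝒳) (hX' : X'.IsCompactSub) :
    ∃ Y' : SubPMM 𝒴, Y'.IsCompactSub ∧ cGHP X'.toPMM Y'.toPMM ≤ cGHP 𝒳 𝒴 ∧
      ∀ r : ℝ, 2 * cGHP 𝒳 𝒴 ≤ r → 𝒳.ballSub r ≤ X' →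
        𝒴.ballSub (r - 2 * cGHP 𝒳 𝒴) ≤ Y' := by
  have : CompactSpace 𝒳.carrier := h𝒳.1
  have : CompactSpace 𝒴.carrier := h𝒴.1
  have : IsFiniteMeasure 𝒳.meas := ⟨h𝒳.2.lt_top⟩
  have : IsFiniteMeasure 𝒴.meas := ⟨h𝒴.2.lt_top⟩
  obtain ⟨D, hDc, hD⟩ := exists_limit 𝒳 𝒴 h𝒳 h𝒴
  set ε := cGHP 𝒳 𝒴 with hε
  have hε0 : 0 ≤ ε := cGHP_nonneg 𝒳 𝒴
  let K : Set (𝒳.carrier × 𝒴.carrier) := {q | D q ≤ ε}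
  have hK : IsClosed K := isClosed_le hDc continuous_const
  have hoo : (𝒳.basepoint, 𝒴.basepoint) ∈ K := by
    refine (le_of_forall_pos_le_add fun δ hδ => ?_ : D (𝒳.basepoint, 𝒴.basepoint) ≤ ε)
    obtain ⟨e, he, hev, heD⟩ := hD (δ / 2) (by linarith)
    have h1 := (value_cond h𝒳 h𝒴 e he _ hev).1
    have h2 := abs_le.1 (heD (𝒳.basepoint, 𝒴.basepoint))
    simp only at h2
    linarith [h2.1]
  have hxy : ∀ x, ∃ y, (x, y) ∈ K := by
    intro x
    obtain ⟨y, -, hy⟩ := isCompact_univ.exists_isMinOn (⟨𝒴.basepoint, trivial⟩ :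
      (Set.univ : Set 𝒴.carrier).Nonempty) (f := fun y => D (x, y)) (by fun_prop)
    refine ⟨y, (le_of_forall_pos_le_add fun δ hδ => ?_ : D (x, y) ≤ ε)⟩
    obtain ⟨e, he, hev, heD⟩ := hD (δ / 2) (by linarith)
    obtain ⟨z, hz⟩ := (value_cond h𝒳 h𝒴 e he _ hev).2.1 x
    have h2 := abs_le.1 (heD (x, z))
    have h3 : D (x, y) ≤ D (x, z) := hy (Set.mem_univ z)
    simp only at h2
    linarith [h2.1]
  have hyx : ∀ y, ∃ x, (x, y) ∈ K := by
    intro y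
    obtain ⟨x, -, hx⟩ := isCompact_univ.exists_isMinOn (⟨𝒳.basepoint, trivial⟩ :
      (Set.univ : Set 𝒳.carrier).Nonempty) (f := fun x => D (x, y)) (by fun_prop)
    refine ⟨x, (le_of_forall_pos_le_add fun δ hδ => ?_ : D (x, y) ≤ ε)⟩
    obtain ⟨e, he, hev, heD⟩ := hD (δ / 2) (by linarith)
    obtain ⟨z, hz⟩ := (value_cond h𝒳 h𝒴 e he _ hev).2.2.1 y
    have h2 := abs_le.1 (heD (z, y))
    have h3 : D (x, y) ≤ D (z, y) := hx (Set.mem_univ z)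
    simp only at h2
    linarith [h2.1]
  have hP1 : ∀ A : Set 𝒳.carrier, IsClosed A →
      𝒳.meas A ≤ 𝒴.meas {y | ∃ x ∈ A, (x, y) ∈ K} + ENNReal.ofReal ε := by
    intro A hA
    refine limit_side 𝒳.meas 𝒴.meas D hDc ε A hA fun δ hδ => ?_
    obtain ⟨e, he, hev, heD⟩ := hD (δ / 2) (by linarith)
    refine ((value_cond h𝒳 h𝒴 e he _ hev).2.2.2.1 A hA).trans
      (add_le_add (measure_mono ?_) (ENNReal.ofReal_le_ofReal (by linarith)))
    rintro y ⟨x, hx, hxy⟩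
    have h2 := abs_le.1 (heD (x, y))
    simp only at h2
    exact ⟨x, hx, by linarith [h2.1]⟩
  have hP2 : ∀ B : Set 𝒴.carrier, IsClosed B →
      𝒴.meas B ≤ 𝒳.meas {x | ∃ y ∈ B, (x, y) ∈ K} + ENNReal.ofReal ε := by
    intro A hA
    refine limit_side 𝒴.meas 𝒳.meas (fun q => D q.swap) (hDc.comp continuous_swap) ε A hA
      fun δ hδ => ?_
    obtain ⟨e, he, hev, heD⟩ := hD (δ / 2) (by linarith)
    refine ((value_cond h𝒳 h𝒴 e he _ hev).2.2.2.2 A hA).trans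
      (add_le_add (measure_mono ?_) (ENNReal.ofReal_le_ofReal (by linarith)))
    rintro x ⟨y, hy, hxy⟩
    have h2 := abs_le.1 (heD (x, y))
    simp only at h2
    exact ⟨y, hy, by simp only [Prod.swap_prod_mk]; linarith [h2.1]⟩
  obtain ⟨α, hαf, hαK, hα1, hα2, hm1, hm2⟩ :=
    finite_strassen 𝒳.meas 𝒴.meas K hK ⟨_, hoo⟩ (ENNReal.ofReal ε) hP1 hP2
  let T : Set 𝒴.carrier := {y | ∃ x ∈ X'.set, (x, y) ∈ K}
  have hT : IsCompact T := by
    have : T = Prod.snd '' ((X'.set ×ˢ Set.univ) ∩ K) := by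
      ext y
      constructor
      · rintro ⟨x, hx, hxy⟩
        exact ⟨(x, y), ⟨⟨hx, trivial⟩, hxy⟩, rfl⟩
      · rintro ⟨⟨x, y⟩, ⟨⟨hx, -⟩, hxy⟩, rfl⟩
        exact ⟨x, hx, hxy⟩
    rw [this]
    exact (((hX'.1.isClosed.prod isClosed_univ).inter hK).isCompact).image continuous_snd
  have hX'm : MeasurableSet X'.set := hX'.1.isClosed.measurableSet
  obtain ⟨ν', α', hν', hν'T, hα'K, hα'1, hα'2, hm1', hm2', hball⟩ :=
    sub_coupling 𝒳.meas 𝒴.meas K (ENNReal.ofReal ε) α hαK hα1 hα2 hm1 hm2 X'.meas X'.meas_le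
      X'.set hX'm X'.supported T hT.isClosed.measurableSet
      (fun q hq hx => ⟨q.1, hx, hq⟩)
  have : IsFiniteMeasure ν' := isFiniteMeasure_of_le 𝒴.meas hν'
  have : IsFiniteMeasure X'.meas := isFiniteMeasure_of_le 𝒳.meas X'.meas_le
  let Y' : SubPMM 𝒴 := ⟨T, ⟨𝒳.basepoint, X'.root_mem, hoo⟩, ν', hν', hν'T⟩
  have hae : ∀ᵐ q ∂α', q ∈ K := hα'K
  refine ⟨Y', ⟨hT, measure_ne_top ν' _⟩, ?_, ?_⟩
  · refine le_of_forall_pos_le_add fun δ hδ => ?_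
    obtain ⟨e, he, hev, heD⟩ := hD δ hδ
    have hKD : ∀ q ∈ K, dist (e.f q.1) (e.g q.2) ≤ ε + δ := by
      intro q hq
      have h2 := abs_le.1 (heD q)
      have h3 : D q ≤ ε := hq
      linarith [h2.2]
    let e' : GHPEmbedding X'.toPMM Y'.toPMM :=
      ⟨e.Z, e.mZ, fun x : X'.set => e.f x.1, fun y : T => e.g y.1⟩
    have he' : e'.IsIsometric :=
      ⟨he.1.comp isometry_subtype_coe, he.2.comp isometry_subtype_coe⟩
    have hle' : cGHP X'.toPMM Y'.toPMM ≤ e'.value :=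
      csInf_le ⟨0, by rintro _ ⟨e, -, rfl⟩; exact value_nonneg e⟩ ⟨e', he', rfl⟩
    refine hle'.trans ?_
    let _ : MeasurableSpace e.Z := borel e.Z
    have : BorelSpace e.Z := ⟨rfl⟩
    refine max_le ?_ (max_le ?_ ?_)
    · exact hKD _ hoo
    · refine Metric.hausdorffDist_le_of_mem_dist (by linarith) ?_ ?_
      · rintro _ ⟨⟨x, hx⟩, rfl⟩
        obtain ⟨y, hy⟩ := hxy x
        exact ⟨_, ⟨⟨y, x, hx, hy⟩, rfl⟩, hKD _ hy⟩
      · rintro _ ⟨⟨y, x, hx, hy⟩, rfl⟩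
        refine ⟨_, ⟨⟨x, hx⟩, rfl⟩, ?_⟩
        rw [dist_comm]
        exact hKD _ hy
    · refine csInf_le ⟨0, fun t ht => ht.1.le⟩ ⟨by linarith, fun A hA => ?_⟩
      have hAm : MeasurableSet A := hA.measurableSet
      have hcm : MeasurableSet (Metric.cthickening (ε + δ) A) :=
        Metric.isClosed_cthickening.measurableSet
      have m1 := fun C hC => map_toPMM_apply X' hX'm e.f he.1.continuous C hC
      have m2 := fun C hC => map_toPMM_apply Y' hT.isClosed.measurableSet e.g he.2.continuous C hC
      have hle : ENNReal.ofReal ε ≤ ENNReal.ofReal (ε + δ) :=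
        ENNReal.ofReal_le_ofReal (by linarith)
      constructor
      · refine (m1 A hAm).le.trans (le_trans ?_ (add_le_add (m2 _ hcm).ge hle))
        refine coupling_side α' Prod.fst Prod.snd measurable_fst measurable_snd X'.meas ν' _
          hα'1 hα'2 hm1' _ _ (he.1.continuous.measurable hAm) (he.2.continuous.measurable hcm) ?_
        filter_upwards [hae] with q hq hqA
        exact Metric.mem_cthickening_of_dist_le _ _ _ _ hqA (by rw [dist_comm]; exact hKD q hq)
      · refine (m2 A hAm).le.trans (le_trans ?_ (add_le_add (m1 _ hcm).ge hle))
        refine coupling_side α' Prod.snd Prod.fst measurable_snd measurable_fst ν' X'.meas _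
          hα'2 hα'1 hm2' _ _ (he.2.continuous.measurable hAm) (he.1.continuous.measurable hcm) ?_
        filter_upwards [hae] with q hq hqA
        exact Metric.mem_cthickening_of_dist_le _ _ _ _ hqA (hKD q hq)
  · intro r hr hrX
    have hKR : ∀ q ∈ K, q.2 ∈ (𝒴.ballSub (r - 2 * ε)).set → q.1 ∈ (𝒳.ballSub r).set := by
      rintro ⟨x, y⟩ hq hy
      have hy' : dist y 𝒴.basepoint ≤ r - 2 * ε := by
        rcases hy with h | h
        · simp only at h
          rw [h, dist_self]; linarith
        · exact h
      refine Or.inr (le_of_forall_pos_le_add fun δ hδ => ?_ : dist x 𝒳.basepoint ≤ r)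
      obtain ⟨e, he, hev, heD⟩ := hD (δ / 2) (by linarith)
      have h1 := (value_cond h𝒳 h𝒴 e he _ hev).1
      have h2 := abs_le.1 (heD (x, y))
      have h3 : D (x, y) ≤ ε := hq
      have h4 := dist_triangle4 (e.f x) (e.g y) (e.g 𝒴.basepoint) (e.f 𝒳.basepoint)
      rw [he.1.dist_eq, he.2.dist_eq, dist_comm (e.g 𝒴.basepoint)] at h4
      simp only at h2 ⊢
      linarith [h2.2]
    have hBT : (𝒴.ballSub (r - 2 * ε)).set ⊆ T := by
      intro y hy
      obtain ⟨x, hx⟩ := hyx y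
      exact ⟨x, hrX.1 (hKR _ hx hy), hx⟩
    refine ⟨hBT, ?_⟩
    exact hball _ _ (measurableSet_closedBall.insert _) (measurableSet_closedBall.insert _)
      hrX.2 hBT hKR

/-- Let `𝒳`, `𝒴` be compact pmm spaces and `ε := dc(𝒳,𝒴)`.
(i) Every compact pmm-subspace `𝒳'` of `𝒳` admits a compact pmm-subspace `𝒴'` of `𝒴` with
`dc(𝒳',𝒴') ≤ dc(𝒳,𝒴)`.
(ii) Moreover, for `r ≥ 2ε`, if in addition `B̄_r(𝒳) ⪯ 𝒳'`, then `𝒴'` can be chosen with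
`B̄_{r-2ε}(𝒴) ⪯ 𝒴'`. -/
theorem cGHP_monotone_subspaces (𝒳 𝒴 : PMM) (h𝒳 : 𝒳.IsCompactPMM) (h𝒴 : 𝒴.IsCompactPMM) :
    (∀ X' : SubPMM 𝒳, X'.IsCompactSub →
      ∃ Y' : SubPMM 𝒴, Y'.IsCompactSub ∧ cGHP X'.toPMM Y'.toPMM ≤ cGHP 𝒳 𝒴) ∧
    (∀ r : ℝ, 2 * cGHP 𝒳 𝒴 ≤ r → ∀ X' : SubPMM 𝒳, X'.IsCompactSub → 𝒳.ballSub r ≤ X' →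
      ∃ Y' : SubPMM 𝒴, Y'.IsCompactSub ∧ 𝒴.ballSub (r - 2 * cGHP 𝒳 𝒴) ≤ Y' ∧
        cGHP X'.toPMM Y'.toPMM ≤ cGHP 𝒳 𝒴) := by
  refine ⟨fun X' hX' => ?_, fun r hr X' hX' hrX => ?_⟩
  · obtain ⟨Y', h1, h2, -⟩ := cGHP_core 𝒳 𝒴 h𝒳 h𝒴 X' hX'
    exact ⟨Y', h1, h2⟩
  · obtain ⟨Y', h1, h2, h3⟩ := cGHP_core 𝒳 𝒴 h𝒳 h𝒴 X' hX'
    exact ⟨Y', h1, h3 r hr hrX, h2⟩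

end
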